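/- If A ∈ M_n(𝕋) is tropically regular, then the matrix A^∇ = Adj(A) ⊙ |A|^{-1} is a pseudo inverse of A: both A ⊙ A^∇ and A^∇ ⊙ A are pseudo unit matrices, i.e. A ⊙ A^∇ ∈ U_n(𝕋) and A^∇ ⊙ A ∈ U_n(𝕋). -/

import Mathlib

/-- The extended tropical semiring `𝕋 = ℝ ∪ {−∞} ∪ ℝ^ν`:
`neginf` is `−∞`, `real a` is the real (tangible) element `a`,
and `ghost a` is the ghost element `a^ν`. -/
inductive T : Type where
  | neginf : T
  | real : ℝ → T
  | ghost : ℝ → T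

namespace T

/-- Tropical addition `⊕` on `𝕋`. -/
noncomputable def add : T → T → T
  | neginf, x => x
  | real a, neginf => real a
  | ghost a, neginf => ghost a
  | real a, real b => if a < b then real b else if b < a then real a else ghost a
  | real a, ghost b => if a ≤ b then ghost b else real a
  | ghost a, real b => if b ≤ a then ghost a else real b
  | ghost a, ghost b => if a < b then ghost b else ghost a

/-- Tropical multiplication `⊙` on `𝕋`. -/
noncomputable def mul : T → T → T
  | neginf, _ => neginf
  | real _, neginf => neginf
  | ghost _, neginf => neginf
  | real a, real b => real (a + b)
  | real a, ghost b => ghost (a + b)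
  | ghost a, real b => ghost (a + b)
  | ghost a, ghost b => ghost (a + b)

/-- The strict order `≺` on `𝕋`. -/
def lt : T → T → Prop
  | neginf, neginf => False
  | neginf, real _ => True
  | neginf, ghost _ => True
  | real _, neginf => False
  | ghost _, neginf => False
  | real a, real b => a < b
  | real a, ghost b => a ≤ b
  | ghost a, real b => a < b
  | ghost a, ghost b => a < b

/-- The order `⪯` on `𝕋`: `x ⪯ y` iff `x = y` or `x ≺ y`. -/
def le (x y : T) : Prop := x = y ∨ lt x y

/-- Membership in `ℝ̄^ν = ℝ^ν ∪ {−∞}` (the ghost elements together with `−∞`). -/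
def isGhost : T → Prop
  | neginf => True
  | real _ => False
  | ghost _ => True

/-- Membership in `ℝ` (the real, tangible elements). -/
def isReal : T → Prop
  | neginf => False
  | real _ => True
  | ghost _ => False

/-- The ghost map `ν : 𝕋 → ℝ̄^ν`. -/
def nu : T → T
  | neginf => neginf
  | real a => ghost a
  | ghost a => ghost a

/-- The projection `π : 𝕋 → ℝ ∪ {−∞}` onto the max-plus semiring `(ℝ ∪ {−∞}, max, +)`,
realized as `WithBot ℝ`. -/
def pi : T → WithBot ℝ
  | neginf => ⊥
  | real a => (a : WithBot ℝ)
  | ghost a => (a : WithBot ℝ)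

/-- The embedding `θ : (ℝ ∪ {−∞}, max, +) → 𝕋`, `a ↦ a^ν`, `−∞ ↦ −∞`. -/
def theta : WithBot ℝ → T :=
  fun x => WithBot.recBotCoe neginf (fun a => ghost a) x

/-- `pow x n` is the `n`-fold tropical product `x ⊙ x ⊙ ⋯ ⊙ x` (with `pow x 0 = 0`, the one). -/
noncomputable def pow (x : T) : ℕ → T
  | 0 => real 0
  | n + 1 => mul x (pow x n)

instance : Std.Commutative add := ⟨by
  intro x y
  cases x <;> cases y <;> simp only [add] <;> split_ifs <;>
    first | rfl | (exfalso; linarith) | (congr 1; linarith)⟩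

instance : Std.Associative add := ⟨by
  intro x y z
  cases x <;> cases y <;> cases z <;>
    simp only [add] <;>
    repeat' (first | split_ifs | simp only [add]) 
  all_goals first | rfl | (exfalso; linarith) | (congr 1; linarith)⟩

instance : Std.Commutative mul := ⟨by
  intro x y
  cases x <;> cases y <;> simp only [mul] <;> congr 1 <;> ring⟩

instance : Std.Associative mul := ⟨by
  intro x y z
  cases x <;> cases y <;> cases z <;> simp only [mul] <;> congr 1 <;> ring⟩

/-- Finite tropical sum `⊕` over a finite index set. -/
noncomputable def sumT {ι : Type*} (s : Finset ι) (f : ι → T) : T := s.fold add neginf f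

/-- Finite tropical product `⊙` over a finite index set. -/
noncomputable def prodT {ι : Type*} (s : Finset ι) (f : ι → T) : T := s.fold mul (real 0) f

/-- Tropical matrix multiplication over `𝕋`. -/
noncomputable def matMul {n : ℕ} (A B : Matrix (Fin n) (Fin n) T) : Matrix (Fin n) (Fin n) T :=
  fun i j => sumT Finset.univ fun k => mul (A i k) (B k j)

/-- The tropical determinant (permanent) `|A| = ⊕_{σ ∈ S_n} a_{1σ(1)} ⊙ ⋯ ⊙ a_{nσ(n)}`. -/
noncomputable def det {n : ℕ} (A : Matrix (Fin n) (Fin n) T) : T :=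
  sumT Finset.univ fun σ : Equiv.Perm (Fin n) => prodT Finset.univ fun i => A i (σ i)

/-- `A` is tropically regular if `|A| ∈ ℝ`. -/
def regular {n : ℕ} (A : Matrix (Fin n) (Fin n) T) : Prop := isReal (det A)

/-- `A` is tropically singular if `|A| ∈ ℝ̄^ν`. -/
def singular {n : ℕ} (A : Matrix (Fin n) (Fin n) T) : Prop := isGhost (det A)

/-- The minor `A_{ij}`: delete row `i` and column `j`. -/
noncomputable def minor {n : ℕ} (A : Matrix (Fin (n+1)) (Fin (n+1)) T) (i j : Fin (n+1)) :
    Matrix (Fin n) (Fin n) T :=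
  A.submatrix i.succAbove j.succAbove

/-- The adjoint matrix `Adj(A)`, the transpose of the matrix of minors' determinants. -/
noncomputable def adj {n : ℕ} (A : Matrix (Fin (n+1)) (Fin (n+1)) T) :
    Matrix (Fin (n+1)) (Fin (n+1)) T :=
  fun i j => det (minor A j i)

/-- The `⊙`-inverse `x^{-1}` (only meaningful away from `−∞`): `a ↦ −a`, `a^ν ↦ (−a)^ν`. -/
def dinv : T → T
  | neginf => neginf
  | real a => real (-a)
  | ghost a => ghost (-a)

/-- The pseudo inverse `A^∇ = Adj(A) ⊙ |A|^{-1}`. -/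
noncomputable def pinv {n : ℕ} (A : Matrix (Fin (n+1)) (Fin (n+1)) T) :
    Matrix (Fin (n+1)) (Fin (n+1)) T :=
  fun i j => mul (adj A i j) (dinv (det A))

/-- A pseudo unit matrix: tropically regular, `0` on the diagonal,
and ghosts (or `−∞`) off the diagonal. -/
def pseudoUnit {n : ℕ} (E : Matrix (Fin n) (Fin n) T) : Prop :=
  regular E ∧ (∀ i, E i i = real 0) ∧ ∀ i j, i ≠ j → isGhost (E i j)

/-- `A` is pseudo invertible if `A ⊙ B` and `B ⊙ A` are pseudo units for some `B`. -/
def pseudoInvertible {n : ℕ} (A : Matrix (Fin n) (Fin n) T) : Prop :=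
  ∃ B, pseudoUnit (matMul A B) ∧ pseudoUnit (matMul B A)

/-- The ray/point `P_x ⊆ ℝ ∪ {−∞}` assigned to `x ∈ 𝕋`:
`P_{−∞} = {−∞}`, `P_a = {a}`, `P_{a^ν} = [−∞, a]`. -/
def P : T → Set (WithBot ℝ)
  | neginf => {⊥}
  | real a => {(a : WithBot ℝ)}
  | ghost a => {t | t ≤ (a : WithBot ℝ)}

end T

namespace T

noncomputable instance : Add T := ⟨add⟩

noncomputable instance : Mul T := ⟨mul⟩

instance : Zero T := ⟨neginf⟩

noncomputable instance : One T := ⟨real 0⟩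

/-- The extended tropical semiring is a commutative semiring. -/
noncomputable instance instCommSemiring : CommSemiring T where
  add_assoc := Std.Associative.assoc (op := add)
  zero_add x := by cases x <;> rfl
  add_zero x := by cases x <;> rfl
  add_comm := Std.Commutative.comm (op := add)
  nsmul := nsmulRec
  mul_assoc := Std.Associative.assoc (op := mul)
  one_mul x := by
    change mul (real 0) x = x
    cases x <;> simp [mul]
  mul_one x := by
    change mul x (real 0) = x
    cases x <;> simp [mul]
  zero_mul x := rfl
  mul_zero x := by cases x <;> rfl
  mul_comm := Std.Commutative.comm (op := mul)
  left_distrib x y z := by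
    change mul x (add y z) = add (mul x y) (mul x z)
    cases x <;> cases y <;> cases z <;> simp only [add, mul, add_lt_add_iff_left,
      add_le_add_iff_left] <;>
      split_ifs <;>
      first | rfl | (exfalso; linarith) | (change ghost _ = ghost _; congr 1; linarith)
  right_distrib y z x := by
    change mul (add y z) x = add (mul y x) (mul z x)
    cases x <;> cases y <;> cases z <;> simp only [add, mul, add_lt_add_iff_right,
      add_le_add_iff_right] <;>
      split_ifs <;>
      first | rfl | (exfalso; linarith) | (change ghost _ = ghost _; congr 1; linarith)

lemma sumT_eq_sum {ι : Type*} (s : Finset ι) (f : ι → T) : sumT s f = ∑ i ∈ s, f i := by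
  classical
  induction s using Finset.induction_on with
  | empty => rfl
  | insert a s ha ih =>
    rw [Finset.sum_insert ha, ← ih]
    exact Finset.fold_insert ha

lemma prodT_eq_prod {ι : Type*} (s : Finset ι) (f : ι → T) : prodT s f = ∏ i ∈ s, f i := by
  classical
  induction s using Finset.induction_on with
  | empty => rfl
  | insert a s ha ih =>
    rw [Finset.prod_insert ha, ← ih]
    exact Finset.fold_insert ha

lemma det_eq_sum {n : ℕ} (A : Matrix (Fin n) (Fin n) T) :
    det A = ∑ σ : Equiv.Perm (Fin n), ∏ i, A i (σ i) := by
  simp only [det, sumT_eq_sum, prodT_eq_prod]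

lemma det_eq_permanent {n : ℕ} (A : Matrix (Fin n) (Fin n) T) : det A = A.transpose.permanent :=
  det_eq_sum A

lemma matMul_apply {n : ℕ} (A B : Matrix (Fin n) (Fin n) T) (i j : Fin n) :
    matMul A B i j = ∑ k, A i k * B k j :=
  sumT_eq_sum _ _

lemma det_transpose {n : ℕ} (A : Matrix (Fin n) (Fin n) T) : det A.transpose = det A := by
  rw [det_eq_permanent, det_eq_permanent, Matrix.permanent_transpose]

@[simp] lemma pi_zero : pi 0 = ⊥ := rfl

@[simp] lemma pi_one : pi 1 = 0 := rfl

lemma pi_add (x y : T) : pi (x + y) = max (pi x) (pi y) := by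
  change pi (add x y) = _
  cases x <;> cases y <;> simp only [add] <;> (try split_ifs) <;> simp [pi] <;>
    linarith

lemma pi_mul (x y : T) : pi (x * y) = pi x + pi y := by
  change pi (mul x y) = _
  cases x <;> cases y <;> simp [mul, pi]

lemma pi_prod {ι : Type*} (s : Finset ι) (f : ι → T) : pi (∏ i ∈ s, f i) = ∑ i ∈ s, pi (f i) := by
  classical
  induction s using Finset.induction_on with
  | empty => simp
  | insert a s ha ih => rw [Finset.prod_insert ha, Finset.sum_insert ha, pi_mul, ih]

lemma exists_pi_sum_eq {ι : Type*} {s : Finset ι} (hs : s.Nonempty) (f : ι → T) :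
    ∃ i ∈ s, pi (∑ j ∈ s, f j) = pi (f i) := by
  classical
  induction hs using Finset.Nonempty.cons_induction with
  | singleton a => simp
  | cons a s ha hs ih =>
    obtain ⟨i, hi, h⟩ := ih
    rw [Finset.sum_cons, pi_add, h]
    rcases max_choice (pi (f a)) (pi (f i)) with h' | h' <;> rw [h']
    · exact ⟨a, by simp, rfl⟩
    · exact ⟨i, by simp [hi], rfl⟩

lemma pi_le_pi_sum {ι : Type*} {s : Finset ι} (f : ι → T) {i : ι} (hi : i ∈ s) :
    pi (f i) ≤ pi (∑ j ∈ s, f j) := by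
  classical
  rw [← Finset.add_sum_erase s f hi, pi_add]
  exact le_max_left _ _

lemma pi_sum_lt {ι : Type*} {s : Finset ι} {f : ι → T} {c : ℝ}
    (h : ∀ i ∈ s, pi (f i) < (c : WithBot ℝ)) : pi (∑ j ∈ s, f j) < (c : WithBot ℝ) := by
  rcases s.eq_empty_or_nonempty with rfl | hs
  · simp
  · obtain ⟨i, hi, h'⟩ := exists_pi_sum_eq hs f
    exact h' ▸ h i hi

lemma add_eq_real {x y : T} {c : ℝ} (h : x + y = real c) :
    (x = real c ∧ pi y < (c : WithBot ℝ)) ∨ (y = real c ∧ pi x < (c : WithBot ℝ)) := by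
  change add x y = _ at h
  cases x <;> cases y <;> simp only [add] at h <;> (try split_ifs at h) <;> simp_all [pi]

lemma real_add_of_lt {y : T} {c : ℝ} (h : pi y < (c : WithBot ℝ)) : real c + y = real c := by
  change add (real c) y = _
  cases y with
  | neginf => rfl
  | real b =>
    have h : b < c := WithBot.coe_lt_coe.1 h
    simp [add, h, h.not_gt]
  | ghost b =>
    have h : b < c := WithBot.coe_lt_coe.1 h
    simp [add, h]

/-- A tropical sum is tangible only if its maximum is tangible and attained exactly once. -/
lemma exists_of_sum_eq_real {ι : Type*} {s : Finset ι} {f : ι → T} {c : ℝ}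
    (h : ∑ j ∈ s, f j = real c) :
    ∃ i ∈ s, f i = real c ∧ ∀ j ∈ s, j ≠ i → pi (f j) < (c : WithBot ℝ) := by
  classical
  induction s using Finset.induction_on with
  | empty => cases h
  | insert a s ha ih =>
    rw [Finset.sum_insert ha] at h
    rcases add_eq_real h with ⟨h₁, h₂⟩ | ⟨h₁, h₂⟩
    · refine ⟨a, by simp, h₁, fun j hj hja => ?_⟩
      exact (pi_le_pi_sum f (Finset.mem_of_mem_insert_of_ne hj hja)).trans_lt h₂
    · obtain ⟨i, hi, h₃, h₄⟩ := ih h₁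
      refine ⟨i, by simp [hi], h₃, fun j hj hji => ?_⟩
      rcases Finset.mem_insert.1 hj with rfl | hj
      · exact h₂
      · exact h₄ j hj hji

lemma sum_eq_real {ι : Type*} {s : Finset ι} {f : ι → T} {c : ℝ} {i : ι} (hi : i ∈ s)
    (hf : f i = real c) (h : ∀ j ∈ s, j ≠ i → pi (f j) < (c : WithBot ℝ)) :
    ∑ j ∈ s, f j = real c := by
  classical
  rw [← Finset.add_sum_erase s f hi, hf]
  exact real_add_of_lt (pi_sum_lt fun j hj =>
    h j (Finset.mem_of_mem_erase hj) (Finset.ne_of_mem_erase hj))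

lemma isGhost_add_self (x : T) : isGhost (x + x) := by
  change isGhost (add x x)
  cases x <;> simp [add, isGhost]

lemma isGhost.mul_right {x : T} (hx : isGhost x) (y : T) : isGhost (x * y) := by
  change isGhost (mul x y)
  cases x <;> cases y <;> simp_all [mul, isGhost]

/-- The permanent of a matrix with two equal rows is a ghost. -/
lemma isGhost_det_of_row_eq {n : ℕ} {A : Matrix (Fin n) (Fin n) T} {i j : Fin n} (hij : i ≠ j)
    (h : A i = A j) : isGhost (det A) := by
  have hswap : ∑ σ : Equiv.Perm (Fin n) with ¬ Equiv.Perm.sign σ = 1, ∏ l, A l (σ l) =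
      ∑ σ : Equiv.Perm (Fin n) with Equiv.Perm.sign σ = 1, ∏ l, A l (σ l) := by
    have hsign (σ : Equiv.Perm (Fin n)) :
        Equiv.Perm.sign (σ * Equiv.swap i j) = - Equiv.Perm.sign σ := by
      simp [Equiv.Perm.sign_swap hij]
    refine Finset.sum_nbij' (· * Equiv.swap i j) (· * Equiv.swap i j) ?_ ?_ ?_ ?_ ?_
    · intro σ hσ
      rcases Int.units_eq_one_or (Equiv.Perm.sign σ) with h' | h' <;> simp_all
    · intro σ hσ
      simp_all
    · intro σ _
      simp [mul_assoc]
    · intro σ _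
      simp [mul_assoc]
    · intro σ _
      refine Fintype.prod_equiv (Equiv.swap i j) _ _ fun l => ?_
      have hA : A (Equiv.swap i j l) = A l := by
        rcases eq_or_ne l i with rfl | hli
        · simp [h]
        rcases eq_or_ne l j with rfl | hlj
        · simp [h]
        · rw [Equiv.swap_apply_of_ne_of_ne hli hlj]
      simp [hA]
  rw [det_eq_sum, ← Finset.sum_filter_add_sum_filter_not _ (fun σ => Equiv.Perm.sign σ = 1),
    hswap]
  exact isGhost_add_self _

/-- The permanent of a minor, as a sum over the permutations sending `j` to `k`. -/
lemma det_minor {n : ℕ} (A : Matrix (Fin (n + 1)) (Fin (n + 1)) T) (j k : Fin (n + 1)) :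
    det (minor A j k) =
      ∑ τ : Equiv.Perm (Fin (n + 1)) with τ j = k, ∏ l, A (j.succAbove l) (τ (j.succAbove l)) := by
  have hsucc (ρ : Equiv.Perm (Fin n)) (l : Fin n) :
      ((finSuccEquiv' j).trans (ρ.optionCongr.trans (finSuccEquiv' k).symm)) (j.succAbove l) =
        k.succAbove (ρ l) := by
    simp
  rw [det_eq_sum]
  refine Finset.sum_bij (fun ρ _ => (finSuccEquiv' j).trans
    (ρ.optionCongr.trans (finSuccEquiv' k).symm)) ?_ ?_ ?_ ?_
  · simp
  · intro ρ _ ρ' _ h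
    ext l : 1
    have := DFunLike.congr_fun h (j.succAbove l)
    rw [hsucc, hsucc] at this
    exact Fin.succAbove_right_injective this
  · intro τ hτ
    have hτ : τ j = k := by simpa using hτ
    let e : Equiv.Perm (Option (Fin n)) :=
      (finSuccEquiv' j).symm.trans (τ.trans (finSuccEquiv' k))
    have he : e none = none := by simp [e, hτ]
    refine ⟨Equiv.removeNone e, Finset.mem_univ _, ?_⟩
    have : (Equiv.removeNone e).optionCongr = e := by
      ext x : 1
      cases x with
      | none => simp [he]
      | some x =>
        simp only [Equiv.optionCongr_apply, Option.map_some]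
        refine Equiv.removeNone_some e ?_
        by_contra hx
        have hx : e (some x) = none := by
          cases hex : e (some x) with
          | none => rfl
          | some y => exact (hx ⟨y, hex⟩).elim
        exact Option.some_ne_none x (e.injective (hx.trans he.symm))
    rw [this]
    ext l
    simp [e]
  · intro ρ _
    simp only [hsucc]
    rfl

/-- Laplace expansion of the permanent along a replaced row. -/
lemma sum_mul_adj {n : ℕ} (A : Matrix (Fin (n + 1)) (Fin (n + 1)) T) (v : Fin (n + 1) → T)
    (j : Fin (n + 1)) : ∑ k, v k * adj A k j = det (A.updateRow j v) := by
  rw [det_eq_sum, ← Finset.sum_fiberwise _ (fun τ : Equiv.Perm (Fin (n + 1)) => τ j)]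
  refine Finset.sum_congr rfl fun k _ => ?_
  rw [adj, det_minor, Finset.mul_sum]
  refine Finset.sum_congr rfl fun τ hτ => ?_
  rw [Fin.prod_univ_succAbove _ j]
  simp [(Finset.mem_filter.1 hτ).2]

lemma matMul_pinv_apply {n : ℕ} (A : Matrix (Fin (n + 1)) (Fin (n + 1)) T) (i j : Fin (n + 1)) :
    matMul A (pinv A) i j = det (A.updateRow j (A i)) * dinv (det A) := by
  rw [matMul_apply, ← sum_mul_adj, Finset.sum_mul]
  exact Finset.sum_congr rfl fun k _ => (mul_assoc _ _ _).symm

/-- If `τ₀` is the unique permutation of maximal weight, then every doubly stochastic matrix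
supported on the allowed entries, other than that of `τ₀`, has smaller weight. -/
lemma sum_mul_lt_of_mem_doublyStochastic {ι : Type*} [Fintype ι] [DecidableEq ι]
    {M : Matrix ι ι ℝ} (hM : M ∈ doublyStochastic ℝ ι) {S : ι → ι → Prop} {b : ι → ι → ℝ}
    {τ₀ : Equiv.Perm ι} {c : ℝ} (h₀ : ∑ i, b i (τ₀ i) = c)
    (h : ∀ τ : Equiv.Perm ι, τ ≠ τ₀ → (∀ i, S i (τ i)) → ∑ i, b i (τ i) < c)
    (hS : ∀ i j, M i j ≠ 0 → S i j) (hne : ∃ i j, M i j ≠ 0 ∧ τ₀ i ≠ j) :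
    ∑ i, ∑ j, M i j * b i j < c := by
  obtain ⟨w, hw₀, hw₁, rfl⟩ := exists_eq_sum_perm_of_mem_doublyStochastic hM
  have hentry (i j : ι) : (∑ σ, w σ • σ.permMatrix ℝ) i j = ∑ σ, if σ i = j then w σ else 0 := by
    simp [Matrix.sum_apply, PEquiv.toMatrix_apply, eq_comm]
  have hsum : ∑ i, ∑ j, (∑ σ, w σ • σ.permMatrix ℝ) i j * b i j =
      ∑ σ, w σ * ∑ i, b i (σ i) := by
    simp only [hentry, Finset.sum_mul, Finset.mul_sum, ite_mul, zero_mul]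
    rw [Finset.sum_comm (f := fun σ : Equiv.Perm ι => fun i => w σ * b i (σ i))]
    refine Finset.sum_congr rfl fun i _ => ?_
    rw [Finset.sum_comm]
    simp
  have hsupp (σ : Equiv.Perm ι) (hσ : w σ ≠ 0) (i : ι) : S i (σ i) := by
    refine hS _ _ (ne_of_gt ?_)
    rw [hentry]
    refine lt_of_lt_of_le ((hw₀ σ).lt_of_ne' hσ) ?_
    refine le_trans (by simp) (Finset.single_le_sum (f := fun ρ : Equiv.Perm ι =>
      if ρ i = σ i then w ρ else 0) (fun ρ _ => ?_) (Finset.mem_univ σ))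
    split_ifs
    exacts [hw₀ ρ, le_rfl]
  obtain ⟨i, j, hij, hτ₀⟩ := hne
  rw [hentry] at hij
  obtain ⟨σ, -, hσ⟩ := Finset.exists_ne_zero_of_sum_ne_zero hij
  have hσj : σ i = j ∧ w σ ≠ 0 := by simpa using hσ
  rw [hsum]
  calc ∑ σ, w σ * ∑ i, b i (σ i) < ∑ σ, w σ * c := by
        refine Finset.sum_lt_sum (fun ρ _ => ?_) ⟨σ, Finset.mem_univ _, ?_⟩
        · rcases eq_or_ne (w ρ) 0 with hρ | hρ
          · simp [hρ]
          refine mul_le_mul_of_nonneg_left ?_ (hw₀ ρ)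
          rcases eq_or_ne ρ τ₀ with rfl | hρ'
          · exact h₀.le
          · exact (h ρ hρ' (hsupp ρ hρ)).le
        · refine mul_lt_mul_of_pos_left ?_ ((hw₀ σ).lt_of_ne' hσj.2)
          refine h σ ?_ (hsupp σ hσj.2)
          rintro rfl
          exact hτ₀ hσj.1
    _ = c := by rw [← Finset.sum_mul, hw₁, one_mul]

/-- The weights of the matrices obtained from `b` by replacing row `σ i` with row `i` average to
less than the unique maximal weight, unless `σ` is the identity. -/
lemma sum_update_lt {ι : Type*} [Fintype ι] [DecidableEq ι] {S : ι → ι → Prop}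
    {b : ι → ι → ℝ} {τ₀ : Equiv.Perm ι} {c : ℝ} (h₀ : ∑ i, b i (τ₀ i) = c)
    (h : ∀ τ : Equiv.Perm ι, τ ≠ τ₀ → (∀ i, S i (τ i)) → ∑ i, b i (τ i) < c)
    {σ : Equiv.Perm ι} (hσ : σ ≠ 1) (τ : ι → Equiv.Perm ι)
    (hS : ∀ i l, S (Function.update id (σ i) i l) (τ i l)) :
    ∑ i, ∑ l, b (Function.update id (σ i) i l) (τ i l) < Fintype.card ι * c := by
  obtain ⟨i₀, hi₀⟩ : ∃ i, σ i ≠ i := by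
    by_contra! h'
    exact hσ (Equiv.ext h')
  have hpos : (0 : ℝ) < Fintype.card ι := by
    exact_mod_cast Fintype.card_pos_iff.2 ⟨i₀⟩
  set N : ℝ := (Fintype.card ι : ℝ) with hN
  let g (i l : ι) : ι := Function.update id (σ i) i l
  let M : Matrix ι ι ℝ := fun p q =>
    N⁻¹ * ∑ x : ι × ι, if g x.1 x.2 = p ∧ τ x.1 x.2 = q then 1 else 0
  have hM_ne {p q : ι} : M p q ≠ 0 ↔ ∃ i l, g i l = p ∧ τ i l = q := by
    simp only [M, Finset.sum_boole]
    simp [hpos.ne', Finset.filter_eq_empty_iff]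
  have hsum (f : ι → ι → ℝ) : ∑ p, ∑ q, M p q * f p q = N⁻¹ * ∑ i, ∑ l, f (g i l) (τ i l) := by
    simp only [M, mul_assoc, ← Finset.mul_sum]
    congr 1
    simp only [Finset.sum_mul]
    rw [← Fintype.sum_prod_type', ← Fintype.sum_prod_type' fun i l => f (g i l) (τ i l),
      Finset.sum_comm]
    refine Finset.sum_congr rfl fun x _ => ?_
    rw [Finset.sum_eq_single (g x.1 x.2, τ x.1 x.2)]
    · simp
    · intro y _ hy
      rw [if_neg fun h' => hy (Prod.ext h'.1.symm h'.2.symm), zero_mul]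
    · simp
  have hg (f : ι → ℝ) : ∑ i, ∑ l, f (g i l) = N * ∑ l, f l := by
    have hrow (i : ι) : ∑ l, f (g i l) = ∑ l, f l - f (σ i) + f i := by
      rw [← Finset.add_sum_erase _ _ (Finset.mem_univ (σ i)),
        ← Finset.add_sum_erase _ f (Finset.mem_univ (σ i)),
        Finset.sum_congr rfl (fun l hl => by
          rw [show g i l = l from Function.update_of_ne (Finset.ne_of_mem_erase hl) _ _])]
      simp [g]
      ring
    simp only [hrow, Finset.sum_add_distrib, Finset.sum_sub_distrib, Equiv.sum_comp σ f]
    simp [hN]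
  have hM : M ∈ doublyStochastic ℝ ι := by
    rw [mem_doublyStochastic_iff_sum]
    refine ⟨fun p q => ?_, fun p => ?_, fun q => ?_⟩
    · exact mul_nonneg (inv_nonneg.2 hpos.le)
        (Finset.sum_nonneg fun x _ => by positivity)
    · have := hsum fun p' _ => if p' = p then 1 else 0
      rw [hg fun p' => if p' = p then 1 else 0] at this
      simpa [hpos.ne'] using this
    · have := hsum fun _ q' => if q' = q then 1 else 0
      simp only [fun i => Equiv.sum_comp (τ i) fun q' => if q' = q then (1 : ℝ) else 0] at this
      simpa [← hN, hpos.ne'] using this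
  have hlt : ∑ p, ∑ q, M p q * b p q < c := by
    refine sum_mul_lt_of_mem_doublyStochastic hM h₀ h ?_ ?_
    · intro p q hpq
      obtain ⟨i, l, rfl, rfl⟩ := hM_ne.1 hpq
      exact hS i l
    · by_contra! hcon
      have hinj (l : ι) : τ₀ (g i₀ l) = τ i₀ l := hcon _ _ (hM_ne.2 ⟨i₀, l, rfl, rfl⟩)
      have heq : g i₀ (σ i₀) = g i₀ i₀ := by simp [g, hi₀.symm]
      exact hi₀ ((τ i₀).injective (by rw [← hinj, ← hinj, heq]))
  rw [hsum, inv_mul_lt_iff₀ hpos] at hlt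
  exact hlt

/-- Every term of the permanent of `A ⊙ A^∇` other than the diagonal one is below `0`. -/
lemma pi_prod_matMul_pinv_lt {n : ℕ} {A : Matrix (Fin (n + 1)) (Fin (n + 1)) T}
    (hA : regular A) {σ : Equiv.Perm (Fin (n + 1))} (hσ : σ ≠ 1) :
    pi (∏ i, matMul A (pinv A) i (σ i)) < ((0 : ℝ) : WithBot ℝ) := by
  obtain ⟨c, hc⟩ : ∃ c, det A = real c := by
    unfold regular at hA
    cases hd : det A <;> simp_all [isReal]
  have hsum := hc
  rw [det_eq_sum] at hsum
  obtain ⟨τ₀, -, hτ₀, hlt⟩ := exists_of_sum_eq_real hsum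
  have hτ₀ : ∑ i, pi (A i (τ₀ i)) = (c : WithBot ℝ) := by
    rw [← pi_prod, hτ₀]
    rfl
  simp only [Finset.mem_univ, forall_const, pi_prod] at hlt
  choose τ hτ using fun i => exists_pi_sum_eq (s := Finset.univ) Finset.univ_nonempty
    fun τ : Equiv.Perm (Fin (n + 1)) => ∏ l, (A.updateRow (σ i) (A i)) l (τ l)
  have hτ (i : Fin (n + 1)) : pi (det (A.updateRow (σ i) (A i))) =
      ∑ l, pi (A (Function.update id (σ i) i l) (τ i l)) := by
    rw [det_eq_sum, (hτ i).2, pi_prod]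
    refine Finset.sum_congr rfl fun l _ => ?_
    rcases eq_or_ne l (σ i) with rfl | hl
    · simp
    · simp [hl]
  let b (i j : Fin (n + 1)) : ℝ := (pi (A i j)).unbotD 0
  have hb {i j : Fin (n + 1)} (hij : pi (A i j) ≠ ⊥) : pi (A i j) = (b i j : WithBot ℝ) := by
    obtain ⟨x, hx⟩ := WithBot.ne_bot_iff_exists.1 hij
    simp [b, ← hx]
  simp only [pi_prod, matMul_pinv_apply, pi_mul, hc, hτ]
  by_cases hbot : ∀ i l, pi (A (Function.update id (σ i) i l) (τ i l)) ≠ ⊥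
  · have key : ∑ i, ∑ l, b (Function.update id (σ i) i l) (τ i l) <
        Fintype.card (Fin (n + 1)) * c := by
      refine sum_update_lt (S := fun i j => pi (A i j) ≠ ⊥) (τ₀ := τ₀) ?_ ?_ hσ τ hbot
      · have hne : ∀ i, pi (A i (τ₀ i)) ≠ ⊥ := by
          intro i hi
          have : ∑ i, pi (A i (τ₀ i)) = ⊥ := WithBot.sum_eq_bot_iff.2 ⟨i, Finset.mem_univ _, hi⟩
          simp [this] at hτ₀
        rw [Finset.sum_congr rfl fun i _ => hb (hne i)] at hτ₀
        exact_mod_cast hτ₀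
      · intro τ hττ₀ hne
        have := hlt τ hττ₀
        rw [Finset.sum_congr rfl fun i _ => hb (hne i)] at this
        exact_mod_cast this
    rw [Finset.sum_congr rfl fun i _ => by
      rw [Finset.sum_congr rfl fun l _ => hb (hbot i l)]]
    simp only [dinv, pi]
    norm_cast
    rw [Finset.sum_add_distrib]
    simpa using key
  · push Not at hbot
    obtain ⟨i, l, hil⟩ := hbot
    rw [WithBot.sum_eq_bot_iff.2 ⟨i, Finset.mem_univ _, ?_⟩]
    · exact WithBot.bot_lt_coe _
    · rw [WithBot.sum_eq_bot_iff.2 ⟨l, Finset.mem_univ _, hil⟩, WithBot.bot_add]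

lemma pseudoUnit_matMul_pinv {n : ℕ} {A : Matrix (Fin (n + 1)) (Fin (n + 1)) T}
    (hA : regular A) : pseudoUnit (matMul A (pinv A)) := by
  have hdiag (i : Fin (n + 1)) : matMul A (pinv A) i i = real 0 := by
    rw [matMul_pinv_apply, Matrix.updateRow_eq_self]
    unfold regular at hA
    cases hd : det A <;> simp_all [isReal]
    change mul _ _ = _
    simp [mul, dinv]
  refine ⟨?_, hdiag, fun i j hij => ?_⟩
  · have : det (matMul A (pinv A)) = real 0 := by
      rw [det_eq_sum]
      refine sum_eq_real (Finset.mem_univ 1) ?_ fun σ _ hσ => pi_prod_matMul_pinv_lt hA hσ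
      exact Finset.prod_eq_one fun i _ => hdiag i
    rw [regular, this]
    trivial
  · rw [matMul_pinv_apply]
    exact (isGhost_det_of_row_eq hij (by simp [hij])).mul_right _

lemma pinv_transpose {n : ℕ} (A : Matrix (Fin (n + 1)) (Fin (n + 1)) T) :
    pinv A.transpose = (pinv A).transpose := by
  ext i j
  simp only [pinv, adj, Matrix.transpose_apply, det_transpose]
  rw [← det_transpose (minor A i j)]
  rfl

lemma matMul_transpose {n : ℕ} (A B : Matrix (Fin n) (Fin n) T) :
    matMul A.transpose B.transpose = (matMul B A).transpose := by
  ext i j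
  simp only [matMul_apply, Matrix.transpose_apply, mul_comm]

lemma pseudoUnit.of_transpose {n : ℕ} {E : Matrix (Fin n) (Fin n) T}
    (h : pseudoUnit E.transpose) : pseudoUnit E :=
  ⟨by simpa only [regular, det_transpose] using h.1, h.2.1, fun i j hij => h.2.2 j i hij.symm⟩

end T

/-- if `A` is tropically regular then `A^∇ = Adj(A) ⊙ |A|^{-1}`
is a pseudo inverse of `A`: both `A ⊙ A^∇` and `A^∇ ⊙ A` are pseudo unit matrices. -/
theorem pinv_is_pseudo_inverse {n : ℕ} (A : Matrix (Fin (n+1)) (Fin (n+1)) T)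
    (hA : T.regular A) :
    T.pseudoUnit (T.matMul A (T.pinv A)) ∧ T.pseudoUnit (T.matMul (T.pinv A) A) := by
  refine ⟨T.pseudoUnit_matMul_pinv hA, T.pseudoUnit.of_transpose ?_⟩
  rw [← T.matMul_transpose, ← T.pinv_transpose]
  exact T.pseudoUnit_matMul_pinv (by rwa [T.regular, T.det_transpose])
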